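/- Let p ≤ q ≤ r be real numbers with p < r, M ≥ 0, let f : ℝ → ℝ be continuous on ℝ and twice differentiable on [p,r] with |f''(x)| ≤ M on [p,r], and let g(x) = f(p) + ((f(r) − f(p))/(r − p))(x − p) be the linear interpolant of f at p and r. Then |2∫_{(p+q)/2}^{(q+r)/2} (q−x)(g(x) − f(x)) dx| ≤ (M/32)(r−p)⁴. -/

import Mathlib

open intervalIntegral

/-- A function with second derivative at least `-M` on `[p, r]` exceeds its chord by at most
`M / 2 * (x - p) * (r - x)`. -/
theorem sub_chord_le_of_neg_le_second_deriv {p r M : ℝ} (hpr : p < r) {f f' f'' : ℝ → ℝ}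
    (hf' : ∀ x ∈ Set.Icc p r, HasDerivWithinAt f (f' x) (Set.Icc p r) x)
    (hf'' : ∀ x ∈ Set.Icc p r, HasDerivWithinAt f' (f'' x) (Set.Icc p r) x)
    (hbd : ∀ x ∈ Set.Icc p r, -M ≤ f'' x) {x : ℝ} (hx : x ∈ Set.Icc p r) :
    f x - (f p + ((f r - f p) / (r - p)) * (x - p)) ≤ M / 2 * ((x - p) * (r - x)) := by
  have hd : ∀ y ∈ Set.Icc p r, HasDerivWithinAt (fun y => f y + M / 2 * y ^ 2)
      (f' y + M * y) (Set.Icc p r) y := fun y hy => by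
    exact ((hf' y hy).add (((hasDerivWithinAt_id y _).pow 2).const_mul (M / 2))).congr_deriv
      (by simp only [id, Nat.cast_ofNat]; ring)
  have hconv : ConvexOn ℝ (Set.Icc p r) (fun y => f y + M / 2 * y ^ 2) := by
    refine convexOn_of_hasDerivWithinAt2_nonneg (f' := fun y => f' y + M * y)
      (f'' := fun y => f'' y + M) (convex_Icc p r)
      (fun y hy => (hd y hy).continuousWithinAt)
      (fun y hy => (hd y (interior_subset hy)).mono interior_subset)
      (fun y hy => ?_) (fun y hy => by linarith [hbd y (interior_subset hy)])
    exact (((hf'' y (interior_subset hy)).add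
      ((hasDerivWithinAt_id y _).const_mul M)).mono interior_subset).congr_deriv (by ring)
  have h0 : 0 < r - p := sub_pos.2 hpr
  have key := hconv.2 (Set.left_mem_Icc.2 hpr.le) (Set.right_mem_Icc.2 hpr.le)
    (div_nonneg (sub_nonneg.2 hx.2) h0.le) (div_nonneg (sub_nonneg.2 hx.1) h0.le)
    (by field_simp; ring)
  have hcomb : (r - x) / (r - p) * p + (x - p) / (r - p) * r = x := by
    field_simp
    ring
  simp only [smul_eq_mul, hcomb] at key
  have e : (r - x) / (r - p) * (f p + M / 2 * p ^ 2) + (x - p) / (r - p) * (f r + M / 2 * r ^ 2)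
      = f p + ((f r - f p) / (r - p)) * (x - p) + M / 2 * ((x - p) * (r - x))
        + M / 2 * x ^ 2 := by
    field_simp
    ring
  linarith

/-- The error of linear interpolation at the endpoints of `[p, r]`. -/
theorem abs_chord_sub_le {p r M : ℝ} (hpr : p < r) (hM : 0 ≤ M) {f f' f'' : ℝ → ℝ}
    (hf' : ∀ x ∈ Set.Icc p r, HasDerivWithinAt f (f' x) (Set.Icc p r) x)
    (hf'' : ∀ x ∈ Set.Icc p r, HasDerivWithinAt f' (f'' x) (Set.Icc p r) x)
    (hbd : ∀ x ∈ Set.Icc p r, |f'' x| ≤ M) {x : ℝ} (hx : x ∈ Set.Icc p r) :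
    |f p + ((f r - f p) / (r - p)) * (x - p) - f x| ≤ M / 8 * (r - p) ^ 2 := by
  have h1 := sub_chord_le_of_neg_le_second_deriv hpr hf' hf''
    (fun y hy => (abs_le.1 (hbd y hy)).1) hx
  have h2 := sub_chord_le_of_neg_le_second_deriv (f := fun y => -f y) (f' := fun y => -f' y)
    (f'' := fun y => -f'' y) (M := M) hpr (fun y hy => (hf' y hy).neg)
    (fun y hy => (hf'' y hy).neg) (fun y hy => neg_le_neg (abs_le.1 (hbd y hy)).2) hx
  have e : (-f r - -f p) / (r - p) * (x - p) = -((f r - f p) / (r - p) * (x - p)) := by ring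
  have h3 : M / 2 * ((x - p) * (r - x)) ≤ M / 8 * (r - p) ^ 2 := by
    nlinarith [mul_nonneg hM (sq_nonneg ((x - p) - (r - x)))]
  simp only [e] at h2
  rw [abs_le]
  constructor <;> linarith

/-- fourth-order bound on the ALM optimality-condition offset when the
density `f` (with `|f''| ≤ M` on `[p,r]`) is replaced by its linear interpolant `g`,
the integral running between the midpoint cell boundaries. -/
theorem alm_offset_fourth_order (p q r M : ℝ) (hpr : p < r) (hpq : p ≤ q) (hqr : q ≤ r)
    (hM : 0 ≤ M) (f f' f'' : ℝ → ℝ) (hfc : Continuous f)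
    (hf' : ∀ x ∈ Set.Icc p r, HasDerivWithinAt f (f' x) (Set.Icc p r) x)
    (hf'' : ∀ x ∈ Set.Icc p r, HasDerivWithinAt f' (f'' x) (Set.Icc p r) x)
    (hbd : ∀ x ∈ Set.Icc p r, |f'' x| ≤ M)
    (g : ℝ → ℝ)
    (hg : ∀ x : ℝ, g x = f p + ((f r - f p) / (r - p)) * (x - p)) :
    |2 * ∫ x in ((p + q) / 2)..((q + r) / 2), (q - x) * (g x - f x)| ≤
      M / 32 * (r - p) ^ 4 := by
  set K := M / 8 * (r - p) ^ 2 with hK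
  have hK0 : 0 ≤ K := by positivity
  have herr : ∀ x ∈ Set.Icc p r, |g x - f x| ≤ K := fun x hx => by
    rw [hg]
    exact abs_chord_sub_le hpr hM hf' hf'' hbd hx
  have hgc : Continuous g := by
    rw [funext hg]
    fun_prop
  have hint : ∀ a b : ℝ, IntervalIntegrable (fun x => (q - x) * (g x - f x))
      MeasureTheory.volume a b := fun a b => Continuous.intervalIntegrable (by fun_prop) a b
  have hprim : ∀ a b c : ℝ, ∫ x in a..b, c * (q - x) = c * ((q - a) ^ 2 - (q - b) ^ 2) / 2 := by
    intro a b c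
    rw [intervalIntegral.integral_const_mul, intervalIntegral.integral_comp_sub_left (fun x => x),
      integral_id]
    ring
  have hleft : |∫ x in ((p + q) / 2)..q, (q - x) * (g x - f x)| ≤ K * ((q - p) / 2) ^ 2 / 2 := by
    have h := intervalIntegral.norm_integral_le_of_norm_le (a := (p + q) / 2) (b := q)
      (μ := MeasureTheory.volume)
      (f := fun x => (q - x) * (g x - f x)) (g := fun x => K * (q - x)) (by linarith)
      (Filter.Eventually.of_forall fun x hx => by
        rw [Real.norm_eq_abs, abs_mul, abs_of_nonneg (sub_nonneg.2 hx.2), mul_comm]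
        exact mul_le_mul_of_nonneg_right
          (herr x ⟨by linarith [hx.1], hx.2.trans hqr⟩) (sub_nonneg.2 hx.2))
      (Continuous.intervalIntegrable (by fun_prop) _ _)
    rw [hprim, Real.norm_eq_abs] at h
    exact h.trans_eq (by ring)
  have hright : |∫ x in q..((q + r) / 2), (q - x) * (g x - f x)| ≤ K * ((r - q) / 2) ^ 2 / 2 := by
    have h := intervalIntegral.norm_integral_le_of_norm_le (a := q) (b := (q + r) / 2)
      (μ := MeasureTheory.volume)
      (f := fun x => (q - x) * (g x - f x)) (g := fun x => (-K) * (q - x)) (by linarith)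
      (Filter.Eventually.of_forall fun x hx => by
        rw [Real.norm_eq_abs, abs_mul, abs_of_nonpos (sub_nonpos.2 hx.1.le)]
        have := mul_le_mul_of_nonneg_right
          (herr x ⟨hpq.trans hx.1.le, by linarith [hx.2]⟩) (sub_nonneg.2 hx.1.le)
        linarith)
      (Continuous.intervalIntegrable (by fun_prop) _ _)
    rw [hprim, Real.norm_eq_abs] at h
    exact h.trans_eq (by ring)
  rw [← intervalIntegral.integral_add_adjacent_intervals (hint _ q) (hint q _), abs_mul, abs_two]
  have hsum := abs_add_le (∫ x in ((p + q) / 2)..q, (q - x) * (g x - f x))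
    (∫ x in q..((q + r) / 2), (q - x) * (g x - f x))
  have hprod : 0 ≤ K * ((q - p) * (r - q)) :=
    mul_nonneg hK0 (mul_nonneg (sub_nonneg.2 hpq) (sub_nonneg.2 hqr))
  have hfin : M / 32 * (r - p) ^ 4 = K * (r - p) ^ 2 / 4 := by
    rw [hK]
    ring
  rw [hfin]
  nlinarith
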